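/- Let a : Fin n → ℝ^d be a point configuration whose points affinely span ℝ^d, with n > d+2, and let 1 ≤ k ≤ d. If for every x ∈ Fin n two weight vectors w, w' : Fin n → ℝ induce the same coherent hypersimplicial subdivision at level k of the restricted configuration a|_{Fin n \ {x}}, then w and w' induce the same coherent hypersimplicial subdivision at level k of a. (This says that F^{(k)}(A) is a Minkowski summand of Σ_{x} F^{(k)}(A_{[n]\x}).) -/

import Mathlib

/-- The tile `[X,Y]` (with `X ⊆ Y ⊆ J`) is a `w`-tile of the restricted
configuration `a|_J`. -/
def IsWTileOn {n d : ℕ} (a : Fin n → (Fin d → ℝ)) (w : Fin n → ℝ)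
    (J X Y : Finset (Fin n)) : Prop :=
  ∃ f : (Fin d → ℝ) →ᵃ[ℝ] ℝ,
    (∀ i ∈ X, w i < f (a i)) ∧ (∀ i ∈ Y \ X, f (a i) = w i) ∧
      (∀ i ∈ J \ Y, f (a i) < w i)

/-- `w` and `w'` induce the same coherent hypersimplicial subdivision at level `k`
of the restricted configuration `a|_J`. -/
def SameHypOn {n d : ℕ} (a : Fin n → (Fin d → ℝ)) (w w' : Fin n → ℝ)
    (J : Finset (Fin n)) (k : ℕ) : Prop :=
  ∀ X Y : Finset (Fin n), X ⊆ Y → Y ⊆ J → X.card < k → k < Y.card →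
    (IsWTileOn a w J X Y ↔ IsWTileOn a w' J X Y)

/-- `w` and `w'` induce the same coherent hypersimplicial subdivision at level `k`
of the full configuration `a`. -/
def SameHyp {n d : ℕ} (a : Fin n → (Fin d → ℝ)) (w w' : Fin n → ℝ) (k : ℕ) : Prop :=
  SameHypOn a w w' Finset.univ k

open Finset in
/-- A tile all of whose one-point deletions are tiles is a tile, by Helly's theorem. -/
theorem IsWTileOn.of_deletions {n d : ℕ} {a : Fin n → (Fin d → ℝ)} {w : Fin n → ℝ}
    {X Y : Finset (Fin n)} (hn : d + 2 < n)
    (h : ∀ x, IsWTileOn a w {x}ᶜ (X.erase x) (Y.erase x)) : IsWTileOn a w univ X Y := by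
  have hfin : Module.finrank ℝ ((Fin d → ℝ) →ᵃ[ℝ] ℝ) = d + 1 := by
    simp [AffineMap.finrank_eq]
  let C : Fin n → Set ((Fin d → ℝ) →ᵃ[ℝ] ℝ) := fun i =>
    {f | (i ∈ X → w i < f (a i)) ∧ (i ∈ Y \ X → f (a i) = w i) ∧ (i ∉ Y → f (a i) < w i)}
  have hconv : ∀ i ∈ (univ : Finset (Fin n)), Convex ℝ (C i) := by
    intro i _ f hf g hg s t hs ht hst
    have hs1 : s = 1 - t := by linarith
    have key : (s • f + t • g) (a i) = s * f (a i) + t * g (a i) := by simp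
    refine ⟨fun hi => ?_, fun hi => ?_, fun hi => ?_⟩
    · have h1 := hf.1 hi
      have h2 := hg.1 hi
      exact convex_Ioi (𝕜 := ℝ) (w i) h1 h2 hs ht hst
    · rw [key, hf.2.1 hi, hg.2.1 hi, hs1]
      ring
    · have h1 := hf.2.2 hi
      have h2 := hg.2.2 hi
      exact convex_Iio (𝕜 := ℝ) (w i) h1 h2 hs ht hst
  have hinter : ∀ I ⊆ (univ : Finset (Fin n)),
      #I = Module.finrank ℝ ((Fin d → ℝ) →ᵃ[ℝ] ℝ) + 1 → (⋂ i ∈ I, C i).Nonempty := by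
    intro I _ hI
    obtain ⟨x, hx⟩ : ∃ x, x ∉ I := by
      by_contra! hall
      have : I = univ := eq_univ_of_forall hall
      rw [this, card_univ, Fintype.card_fin] at hI
      omega
    obtain ⟨f, h1, h2, h3⟩ := h x
    refine ⟨f, Set.mem_iInter₂.2 fun i hi => ?_⟩
    have hix : i ≠ x := fun e => hx (e ▸ hi)
    exact ⟨fun hiX => h1 i (by simp [hix, hiX]),
      fun hiY => h2 i (by simp_all), fun hiY => h3 i (by simp_all)⟩
  obtain ⟨f, hf⟩ := Convex.helly_theorem (𝕜 := ℝ) (s := univ)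
    (by rw [hfin, card_univ, Fintype.card_fin]; omega) hconv hinter
  have hf' : ∀ i, f ∈ C i := fun i => Set.mem_iInter₂.1 hf i (mem_univ i)
  exact ⟨f, fun i hi => (hf' i).1 hi, fun i hi => (hf' i).2.1 hi,
    fun i hi => (hf' i).2.2 (mem_sdiff.1 hi).2⟩

/-- Deleting a point from a tile gives a tile of the restricted configuration. -/
theorem IsWTileOn.erase {n d : ℕ} {a : Fin n → (Fin d → ℝ)} {w : Fin n → ℝ}
    {X Y : Finset (Fin n)} (h : IsWTileOn a w Finset.univ X Y) (x : Fin n) :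
    IsWTileOn a w {x}ᶜ (X.erase x) (Y.erase x) := by
  obtain ⟨f, h1, h2, h3⟩ := h
  refine ⟨f, fun i hi => h1 i (Finset.mem_of_mem_erase hi), fun i hi => h2 i ?_,
    fun i hi => h3 i ?_⟩
  · simp only [Finset.mem_sdiff, Finset.mem_erase] at hi ⊢
    tauto
  · simp only [Finset.mem_sdiff, Finset.mem_erase, Finset.mem_compl, Finset.mem_singleton,
      Finset.mem_univ] at hi ⊢
    tauto

/-- Perturbing a tile `[X,Y']` in a direction that vanishes on `Y \ X` and is negative on
`Y' \ Y` gives the tile `[X,Y]`. -/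
theorem IsWTileOn.of_perturbation {n d : ℕ} {a : Fin n → (Fin d → ℝ)} {w : Fin n → ℝ}
    {X Y Y' : Finset (Fin n)} (hXY : X ⊆ Y) (hYY' : Y ⊆ Y')
    (h : IsWTileOn a w Finset.univ X Y') (g : (Fin d → ℝ) →ᵃ[ℝ] ℝ)
    (hg0 : ∀ i ∈ Y \ X, g (a i) = 0) (hgneg : ∀ i ∈ Y' \ Y, g (a i) < 0) :
    IsWTileOn a w Finset.univ X Y := by
  obtain ⟨f, h1, h2, h3⟩ := h
  have hlim : ∀ i, Filter.Tendsto (fun t : ℝ => f (a i) + t * g (a i))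
      (nhdsWithin 0 (Set.Ioi 0)) (nhds (f (a i))) := by
    intro i
    have hc : Continuous fun t : ℝ => f (a i) + t * g (a i) := by fun_prop
    simpa using (hc.tendsto 0).mono_left nhdsWithin_le_nhds
  have hX : ∀ᶠ t : ℝ in nhdsWithin 0 (Set.Ioi 0), ∀ i, i ∈ X → w i < f (a i) + t * g (a i) :=
    Filter.eventually_all.2 fun i => Filter.eventually_imp_distrib_left.2 fun hi =>
      (hlim i).eventually_const_lt (h1 i hi)
  have hY' : ∀ᶠ t : ℝ in nhdsWithin 0 (Set.Ioi 0), ∀ i, i ∉ Y' → f (a i) + t * g (a i) < w i :=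
    Filter.eventually_all.2 fun i => Filter.eventually_imp_distrib_left.2 fun hi =>
      (hlim i).eventually_lt_const (h3 i (by simp [hi]))
  obtain ⟨t, ⟨htX, htY'⟩, ht⟩ := ((hX.and hY').and self_mem_nhdsWithin).exists
  have ht : 0 < t := ht
  have key : ∀ i, (f + t • g) (a i) = f (a i) + t * g (a i) := fun i => by simp
  refine ⟨f + t • g, fun i hi => ?_, fun i hi => ?_, fun i hi => ?_⟩
  · rw [key]
    exact htX i hi
  · rw [key, hg0 i hi, h2 i (Finset.sdiff_subset_sdiff hYY' subset_rfl hi)]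
    ring
  · rw [key]
    by_cases hiY' : i ∈ Y'
    · have hiY : i ∉ Y := (Finset.mem_sdiff.1 hi).2
      rw [h2 i (Finset.mem_sdiff.2 ⟨hiY', fun hx => hiY (hXY hx)⟩)]
      have := mul_neg_of_pos_of_neg ht (hgneg i (Finset.mem_sdiff.2 ⟨hiY', hiY⟩))
      linarith
    · exact htY' i hiY'

/-- Moving a tile `[X,Y]` along a direction `g` until it first meets a point outside `Y`. -/
theorem IsWTileOn.exists_larger_tile {n d : ℕ} {a : Fin n → (Fin d → ℝ)} {w : Fin n → ℝ}
    {X Y : Finset (Fin n)} (h : IsWTileOn a w Finset.univ X Y)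
    (g : (Fin d → ℝ) →ᵃ[ℝ] ℝ) (hgX : ∀ i ∈ X, 0 ≤ g (a i)) (hg0 : ∀ i ∈ Y \ X, g (a i) = 0)
    (hgpos : ∃ j ∉ Y, 0 < g (a j)) :
    ∃ Y', Y ⊂ Y' ∧ IsWTileOn a w Finset.univ X Y' ∧ ∀ i ∈ Y' \ Y, 0 < g (a i) := by
  obtain ⟨f, h1, h2, h3⟩ := h
  have h3 : ∀ i ∉ Y, f (a i) < w i := fun i hi => h3 i (by simp [hi])
  obtain ⟨j₀, hj₀Y, hj₀⟩ := hgpos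
  obtain ⟨j, hj, hmin⟩ := (Finset.univ.filter fun j => j ∉ Y ∧ 0 < g (a j)).exists_min_image
    (fun j => (w j - f (a j)) / g (a j)) ⟨j₀, by simp [hj₀Y, hj₀]⟩
  obtain ⟨hjY, hjpos⟩ : j ∉ Y ∧ 0 < g (a j) := by simpa using hj
  set t := (w j - f (a j)) / g (a j) with ht_def
  have ht : 0 < t := div_pos (sub_pos.2 (h3 j hjY)) hjpos
  have hle : ∀ i ∉ Y, f (a i) + t * g (a i) ≤ w i := by
    intro i hi
    rcases lt_or_ge 0 (g (a i)) with hgi | hgi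
    · have := hmin i (by simp [hi, hgi])
      rw [le_div_iff₀ hgi] at this
      linarith
    · have := mul_nonpos_of_nonneg_of_nonpos ht.le hgi
      linarith [h3 i hi]
  have hjeq : f (a j) + t * g (a j) = w j := by
    rw [ht_def, div_mul_cancel₀ _ hjpos.ne']
    ring
  have key : ∀ i, (f + t • g) (a i) = f (a i) + t * g (a i) := fun i => by simp
  refine ⟨Y ∪ Finset.univ.filter fun i => f (a i) + t * g (a i) = w i,
    Finset.ssubset_iff_subset_ne.2 ⟨Finset.subset_union_left, fun e => hjY ?_⟩,
    ⟨f + t • g, fun i hi => ?_, fun i hi => ?_, fun i hi => ?_⟩, fun i hi => ?_⟩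
  · rw [e]
    simp [hjeq]
  · rw [key]
    have := mul_nonneg ht.le (hgX i hi)
    linarith [h1 i hi]
  · rw [key]
    simp only [Finset.mem_sdiff, Finset.mem_union, Finset.mem_filter, Finset.mem_univ,
      true_and] at hi
    rcases hi with ⟨hi | hi, hiX⟩
    · have hiY := Finset.mem_sdiff.2 ⟨hi, hiX⟩
      rw [hg0 i hiY, h2 i hiY]
      ring
    · exact hi
  · rw [key]
    simp only [Finset.mem_sdiff, Finset.mem_union, Finset.mem_filter, Finset.mem_univ,
      true_and, not_or] at hi
    exact lt_of_le_of_ne (hle i hi.1) hi.2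
  · simp only [Finset.mem_sdiff, Finset.mem_union, Finset.mem_filter, Finset.mem_univ,
      true_and] at hi
    rcases hi with ⟨hi | hi, hiY⟩
    · exact absurd hi hiY
    · exact pos_of_mul_pos_right (by linarith [h3 i hiY]) ht.le

/-- An affine map can be prescribed arbitrarily on at most `d + 1` points if only the zero map
vanishes on them. -/
theorem exists_affineMap_eq_on {n d : ℕ} {a : Fin n → (Fin d → ℝ)} {Y : Finset (Fin n)}
    (hcard : Y.card ≤ d + 1)
    (hY : ∀ g : (Fin d → ℝ) →ᵃ[ℝ] ℝ, (∀ i ∈ Y, g (a i) = 0) → g = 0) (v : Fin n → ℝ) :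
    ∃ f : (Fin d → ℝ) →ᵃ[ℝ] ℝ, ∀ i ∈ Y, f (a i) = v i := by
  have hfin : Module.finrank ℝ ((Fin d → ℝ) →ᵃ[ℝ] ℝ) = d + 1 := by
    simp [AffineMap.finrank_eq]
  let ev : ((Fin d → ℝ) →ᵃ[ℝ] ℝ) →ₗ[ℝ] (Y → ℝ) :=
    { toFun := fun f i => f (a i)
      map_add' := fun f g => by ext; simp
      map_smul' := fun c f => by ext; simp }
  have hinj : Function.Injective ev := by
    refine (injective_iff_map_eq_zero ev).2 fun g hg => hY g fun i hi => ?_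
    exact congrFun hg ⟨i, hi⟩
  have hle := LinearMap.finrank_le_finrank_of_injective hinj
  have hfin' : Module.finrank ℝ (Y → ℝ) = Y.card := by simp
  obtain ⟨f, hf⟩ := (LinearMap.injective_iff_surjective_of_finrank_eq_finrank
    (by omega)).1 hinj fun i => v i
  exact ⟨f, fun i hi => congrFun hf ⟨i, hi⟩⟩

/-- If every direction in the recession cone of `[X,Y]` is nonpositive off `Y`, and the
inequality at each point off `Y` can be satisfied separately, then `[X,Y]` is a tile. -/
theorem IsWTileOn.of_recession {n d : ℕ} {a : Fin n → (Fin d → ℝ)}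
    (hspan : affineSpan ℝ (Set.range a) = ⊤) {w : Fin n → ℝ} {X Y : Finset (Fin n)}
    (hXY : X ⊆ Y) (hcard : Y.card ≤ d + 1)
    (hrec : ∀ g : (Fin d → ℝ) →ᵃ[ℝ] ℝ, (∀ i ∈ X, 0 ≤ g (a i)) →
      (∀ i ∈ Y \ X, g (a i) = 0) → ∀ j ∉ Y, g (a j) ≤ 0)
    (hsep : ∀ j ∉ Y, ∃ f : (Fin d → ℝ) →ᵃ[ℝ] ℝ,
      (∀ i ∈ Y \ X, f (a i) = w i) ∧ f (a j) < w j) :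
    IsWTileOn a w Finset.univ X Y := by
  have hker : ∀ g : (Fin d → ℝ) →ᵃ[ℝ] ℝ, (∀ i ∈ Y, g (a i) = 0) → g = 0 := by
    intro g hg
    refine AffineMap.ext_on hspan ?_
    rintro _ ⟨i, rfl⟩
    change g (a i) = 0
    by_cases hi : i ∈ Y
    · exact hg i hi
    · have h1 := hrec g (fun i hi => (hg i (hXY hi)).ge)
        (fun i hi => hg i (Finset.mem_sdiff.1 hi).1) i hi
      have h2 := hrec (-g) (fun i hi => by simp [hg i (hXY hi)])
        (fun i hi => by simp [hg i (Finset.mem_sdiff.1 hi).1]) i hi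
      simp only [AffineMap.coe_neg, Pi.neg_apply] at h2
      linarith
  have hsep' : ∀ j, ∃ f : (Fin d → ℝ) →ᵃ[ℝ] ℝ,
      j ∉ Y → (∀ i ∈ Y \ X, f (a i) = w i) ∧ f (a j) < w j := by
    intro j
    by_cases hj : j ∈ Y
    · exact ⟨0, fun h => absurd hj h⟩
    · obtain ⟨f, hf⟩ := hsep j hj
      exact ⟨f, fun _ => hf⟩
  choose F hF using hsep'
  obtain ⟨f, hf⟩ := exists_affineMap_eq_on hcard hker
    fun i => if i ∈ X then ∑ j, |F j (a i)| + |w i| + 1 else w i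
  have hfX : ∀ i ∈ X, f (a i) = ∑ j, |F j (a i)| + |w i| + 1 := fun i hi => by
    simp [hf i (hXY hi), hi]
  have hfY : ∀ i ∈ Y \ X, f (a i) = w i := fun i hi => by
    simp [hf i (Finset.mem_sdiff.1 hi).1, (Finset.mem_sdiff.1 hi).2]
  refine ⟨f, fun i hi => ?_, hfY, fun j hj => ?_⟩
  · rw [hfX i hi]
    have : 0 ≤ ∑ j, |F j (a i)| := Finset.sum_nonneg fun j _ => abs_nonneg _
    linarith [le_abs_self (w i)]
  · have hjY := (Finset.mem_sdiff.1 hj).2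
    obtain ⟨hFY, hFj⟩ := hF j hjY
    have := hrec (f - F j) (fun i hi => ?_) (fun i hi => ?_) j hjY
    · simp only [AffineMap.coe_sub, Pi.sub_apply] at this
      linarith
    · have hle : |F j (a i)| ≤ ∑ j, |F j (a i)| :=
        Finset.single_le_sum (f := fun j => |F j (a i)|) (fun j _ => abs_nonneg _)
          (Finset.mem_univ j)
      simp only [AffineMap.coe_sub, Pi.sub_apply, hfX i hi]
      linarith [le_abs_self (F j (a i)), abs_nonneg (w i)]
    · simp [hfY i hi, hFY i hi]

/-- Tiles covering level `k` transfer from `w` to `w'` when they do so for all one-point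
deletions. -/
theorem IsWTileOn.of_sameHypOn_deletions {n d : ℕ} {a : Fin n → (Fin d → ℝ)}
    (hspan : affineSpan ℝ (Set.range a) = ⊤) (hn : d + 2 < n) {k : ℕ} (hk : k ≤ d)
    {w w' : Fin n → ℝ} (hdel : ∀ x : Fin n, SameHypOn a w w' {x}ᶜ k)
    {X Y : Finset (Fin n)} (hXY : X ⊆ Y) (hX : X.card < k) (hY : k < Y.card)
    (h : IsWTileOn a w Finset.univ X Y) : IsWTileOn a w' Finset.univ X Y := by
  have large : ∀ Z : Finset (Fin n), X ⊆ Z → k + 1 < Z.card →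
      IsWTileOn a w Finset.univ X Z → IsWTileOn a w' Finset.univ X Z := by
    intro Z hXZ hZ hw
    refine IsWTileOn.of_deletions hn fun x => ?_
    refine (hdel x _ _ (Finset.erase_subset_erase x hXZ) ?_ ?_ ?_).1 (hw.erase x)
    · intro i hi
      simp [Finset.ne_of_mem_erase hi]
    · exact lt_of_le_of_lt Finset.card_erase_le hX
    · have := Finset.pred_card_le_card_erase (s := Z) (a := x)
      omega
  rcases lt_or_ge (k + 1) Y.card with hY1 | hY1
  · exact large Y hXY hY1 h
  by_cases hrec : ∀ g : (Fin d → ℝ) →ᵃ[ℝ] ℝ, (∀ i ∈ X, 0 ≤ g (a i)) →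
      (∀ i ∈ Y \ X, g (a i) = 0) → ∀ j ∉ Y, g (a j) ≤ 0
  · refine IsWTileOn.of_recession hspan hXY (by omega) hrec fun j hj => ?_
    have hcompl : 1 < Yᶜ.card := by
      rw [Finset.card_compl, Fintype.card_fin]
      omega
    obtain ⟨l, hl, hlj⟩ := Finset.exists_mem_ne hcompl j
    have hl : l ∉ Y := Finset.mem_compl.1 hl
    have hw := h.erase l
    rw [Finset.erase_eq_of_notMem hl, Finset.erase_eq_of_notMem fun hx => hl (hXY hx)] at hw
    obtain ⟨f, -, h2, h3⟩ := (hdel l X Y hXY (fun i hi => by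
      simpa using fun e : i = l => hl (e ▸ hi)) hX hY).1 hw
    exact ⟨f, h2, h3 j (by simp [hj, hlj.symm])⟩
  · push Not at hrec
    obtain ⟨g, hgX, hg0, hgpos⟩ := hrec
    obtain ⟨Y', hYY', hw, hg⟩ := h.exists_larger_tile g hgX hg0 hgpos
    have hlt := Finset.card_lt_card hYY'
    exact (large Y' (hXY.trans hYY'.subset) (by omega) hw).of_perturbation hXY hYY'.subset (-g)
      (fun i hi => by simp [hg0 i hi]) (fun i hi => by simpa using hg i hi)

theorem hypersecondary_summand_of_deletions {n d : ℕ} (a : Fin n → (Fin d → ℝ))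
    (hspan : affineSpan ℝ (Set.range a) = ⊤)
    (hn : d + 2 < n)
    (k : ℕ) (hk1 : 1 ≤ k) (hk2 : k ≤ d)
    (w w' : Fin n → ℝ)
    (hdel : ∀ x : Fin n, SameHypOn a w w' {x}ᶜ k) :
    SameHyp a w w' k := by
  exact fun X Y hXY _ hX hY =>
    ⟨IsWTileOn.of_sameHypOn_deletions hspan hn hk2 hdel hXY hX hY,
      IsWTileOn.of_sameHypOn_deletions hspan hn hk2
        (fun x X Y h₁ h₂ h₃ h₄ => (hdel x X Y h₁ h₂ h₃ h₄).symm) hXY hX hY⟩
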